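/- If f : A → B is an n-homomorphism (n ∈ ℕ), then the map a ↦ ψ_n(f,a) is multiplicative and unital: ψ_n(f, ab) = ψ_n(f,a)·ψ_n(f,b) for all a, b ∈ A, and ψ_n(f, 1_A) = 1_B. Equivalently, the symmetric function (1/n!)·Φ_n(f; a₁,…,a_n), restricted to the diagonal, is multiplicative in a. -/

import Mathlib

noncomputable section

variable {A B : Type*}

/-- The Frobenius forms `Φ_k(f; a₁, …, a_k)`, defined inductively by `Φ₀ = 1`
(so that `Φ₁(f; a) = f a`) and
`Φ_{k+1}(f; a₁, …, a_{k+1}) = f a₁ · Φ_k(f; a₂, …, a_{k+1})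
  − Σ_{i=2}^{k+1} Φ_k(f; a₂, …, a₁·aᵢ, …, a_{k+1})`. -/
def Phi [CommRing A] [CommRing B] [Algebra ℝ A] [Algebra ℝ B]
    (f : A →ₗ[ℝ] B) : (n : ℕ) → (Fin n → A) → B
  | 0, _ => 1
  | n + 1, a =>
      f (a 0) * Phi f n (fun i => a i.succ) -
        ∑ i : Fin n, Phi f n (Function.update (fun j => a j.succ) i (a 0 * a i.succ))

/-- `f : A → B` is an `n`-homomorphism in the sense of Buchstaber–Rees if
`f 1 = n · 1` and `Φ_{n+1}(f; a₁, …, a_{n+1}) = 0` for all arguments. -/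
def IsNHom [CommRing A] [CommRing B] [Algebra ℝ A] [Algebra ℝ B]
    (n : ℕ) (f : A →ₗ[ℝ] B) : Prop :=
  f 1 = (n : B) ∧ ∀ a : Fin (n + 1) → A, Phi f (n + 1) a = 0

/-- The coefficients `ψ_k(f, a)` of the characteristic series, defined by `ψ₀ = 1` and,
for `k ≥ 1`, by the recursion `k·ψ_k(f,a) = Σ_{i=1}^{k} (−1)^{i−1} f(aⁱ)·ψ_{k−i}(f,a)`. -/
def psi [CommRing A] [CommRing B] [Algebra ℝ A] [Algebra ℝ B]
    (f : A →ₗ[ℝ] B) (a : A) : ℕ → B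
  | 0 => 1
  | k + 1 =>
      (((k : ℝ) + 1)⁻¹) • ∑ j ∈ Finset.range (k + 1),
        ((-1 : B) ^ j * f (a ^ (j + 1)) * psi f a (k - j))
  decreasing_by exact Nat.lt_succ_of_le (Nat.sub_le k j)

section TupleMultiplication

variable [CommRing A]

/-- Multiply the `i`-th entry of the tuple `a` by `x`. -/
def mulAt {n : ℕ} (x : A) (i : Fin n) (a : Fin n → A) : Fin n → A :=
  Function.update a i (x * a i)

lemma mulAt_apply {n : ℕ} (x : A) (i j : Fin n) (a : Fin n → A) :
    mulAt x i a j = (if i = j then x else 1) * a j := by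
  unfold mulAt
  by_cases h : i = j
  · subst h; simp
  · simp [h, Function.update_of_ne (Ne.symm h)]

lemma mulAt_comm {n : ℕ} (x y : A) (i j : Fin n) (a : Fin n → A) :
    mulAt x i (mulAt y j a) = mulAt y j (mulAt x i a) := by
  ext k
  simp only [mulAt_apply]
  ring

lemma mulAt_comp_perm {n : ℕ} (x : A) (i : Fin n) (a : Fin n → A) (σ : Equiv.Perm (Fin n)) :
    mulAt x i (a ∘ σ) = mulAt x (σ i) a ∘ σ := by
  ext k
  simp [mulAt_apply]

lemma mulAt_cons_zero {n : ℕ} (x y : A) (a : Fin n → A) :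
    mulAt x 0 (Fin.cons y a : Fin (n + 1) → A) = Fin.cons (x * y) a := by
  simp [mulAt, Fin.update_cons_zero]

lemma mulAt_cons_succ {n : ℕ} (x y : A) (i : Fin n) (a : Fin n → A) :
    mulAt x i.succ (Fin.cons y a : Fin (n + 1) → A) = Fin.cons y (mulAt x i a) := by
  simp [mulAt, Fin.cons_update]

/-- Multiply the entries of `a` by those of `x`, with `x j` acting at position `ι j`. -/
def mulAlong {k n : ℕ} (x : Fin k → A) (ι : Fin k → Fin n) (a : Fin n → A) : Fin n → A :=
  fun i => (∏ j, if ι j = i then x j else 1) * a i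

lemma mulAlong_cons {k n : ℕ} (x : A) (y : Fin k → A) (m : Fin n) (ι : Fin k → Fin n)
    (a : Fin n → A) :
    mulAlong (Fin.cons x y : Fin (k + 1) → A) (Fin.cons m ι : Fin (k + 1) → Fin n) a =
      mulAt x m (mulAlong y ι a) := by
  ext i
  simp only [mulAlong, mulAt_apply, Fin.prod_univ_succ, Fin.cons_zero, Fin.cons_succ]
  ring

lemma mulAlong_mulAt {k n : ℕ} (x : A) (y : Fin k → A) (j : Fin k) (ι : Fin k → Fin n)
    (a : Fin n → A) :
    mulAlong (mulAt x j y) ι a = mulAt x (ι j) (mulAlong y ι a) := by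
  ext i
  simp only [mulAlong, mulAt_apply, ← mul_assoc]
  congr 1
  have h : ∀ l, (if ι l = i then (if j = l then x else 1) * y l else 1) =
      (if j = l then (if ι l = i then x else 1) else 1) * if ι l = i then y l else 1 := by
    intro l
    split_ifs <;> simp
  simp only [h, Finset.prod_mul_distrib, Finset.prod_ite_eq, Finset.mem_univ, if_true]

end TupleMultiplication

section FrobeniusForms

variable [CommRing A] [CommRing B] [Algebra ℝ A] [Algebra ℝ B] (f : A →ₗ[ℝ] B)

lemma Phi_succ (n : ℕ) (a : Fin (n + 1) → A) :
    Phi f (n + 1) a = f (a 0) * Phi f n (Fin.tail a) -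
      ∑ i : Fin n, Phi f n (mulAt (a 0) i (Fin.tail a)) := rfl

lemma Phi_cons (n : ℕ) (x : A) (a : Fin n → A) :
    Phi f (n + 1) (Fin.cons x a) = f x * Phi f n a - ∑ i : Fin n, Phi f n (mulAt x i a) := by
  rw [Phi_succ, Fin.tail_cons, Fin.cons_zero]

lemma Phi_cons_cons_comm (n : ℕ) (x y : A) (a : Fin n → A) :
    Phi f (n + 2) (Fin.cons x (Fin.cons y a : Fin (n + 1) → A)) =
      Phi f (n + 2) (Fin.cons y (Fin.cons x a : Fin (n + 1) → A)) := by
  have expand : ∀ x y : A, Phi f (n + 2) (Fin.cons x (Fin.cons y a : Fin (n + 1) → A)) =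
      f x * f y * Phi f n a - f x * ∑ i, Phi f n (mulAt y i a) -
        Phi f (n + 1) (Fin.cons (x * y) a) - f y * ∑ i, Phi f n (mulAt x i a) +
        ∑ i, ∑ j, Phi f n (mulAt y j (mulAt x i a)) := by
    intro x y
    rw [Phi_cons, Fin.sum_univ_succ, mulAt_cons_zero, Phi_cons f n y a]
    simp only [mulAt_cons_succ, Phi_cons f n y, Finset.sum_sub_distrib, ← Finset.mul_sum]
    ring
  rw [expand x y, expand y x, Finset.sum_comm, mul_comm y x]
  simp only [mulAt_comm y x]
  ring

/-- The Frobenius forms are invariant under exchanging two adjacent arguments. -/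
lemma Phi_comp_swap (n : ℕ) (i : Fin n) (a : Fin (n + 1) → A) :
    Phi f (n + 1) (a ∘ Equiv.swap i.castSucc i.succ) = Phi f (n + 1) a := by
  induction n with
  | zero => exact i.elim0
  | succ n ih =>
    cases i using Fin.cases with
    | zero =>
      have h₁ : a = Fin.cons (a 0) (Fin.cons (a 1) (Fin.tail (Fin.tail a)) : Fin (n + 1) → A) := by
        ext j
        refine Fin.cases rfl (fun j => Fin.cases rfl (fun j => rfl) j) j
      have h₂ : a ∘ Equiv.swap (Fin.castSucc 0) (Fin.succ 0) =
          Fin.cons (a 1) (Fin.cons (a 0) (Fin.tail (Fin.tail a)) : Fin (n + 1) → A) := by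
        ext j
        refine Fin.cases (by simp) (fun j => Fin.cases (by simp) (fun j => ?_) j) j
        have h0 : j.succ.succ ≠ 0 := Fin.succ_ne_zero _
        have h1 : j.succ.succ ≠ 1 := by
          rw [← Fin.succ_zero_eq_one]
          exact fun h => Fin.succ_ne_zero _ (Fin.succ_injective _ h)
        simp [Equiv.swap_apply_of_ne_of_ne h0 h1, Fin.tail]
      rw [h₂, Phi_cons_cons_comm, ← h₁]
    | succ i =>
      have h0 : (a ∘ Equiv.swap i.succ.castSucc i.succ.succ) 0 = a 0 := by
        have h₁ : (0 : Fin (n + 2)) ≠ i.succ.castSucc := by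
          rw [← Fin.succ_castSucc]; exact (Fin.succ_ne_zero _).symm
        rw [Function.comp_apply, Equiv.swap_apply_of_ne_of_ne h₁ (Fin.succ_ne_zero _).symm]
      have ht : Fin.tail (a ∘ Equiv.swap i.succ.castSucc i.succ.succ) =
          Fin.tail a ∘ Equiv.swap i.castSucc i.succ := by
        ext j
        simp only [Fin.tail, Function.comp_apply, ← Fin.succ_castSucc]
        rw [(Fin.succ_injective (n + 1)).swap_apply]
      rw [Phi_succ f (n + 1), Phi_succ f (n + 1), h0, ht]
      simp only [mulAt_comp_perm, ih]
      rw [Equiv.sum_comp (Equiv.swap i.castSucc i.succ)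
        (fun j => Phi f (n + 1) (mulAt (a 0) j (Fin.tail a)))]

lemma Phi_update_const (n : ℕ) (a c : A) (i : Fin (n + 1)) :
    Phi f (n + 1) (Function.update (fun _ => a) i c) =
      Phi f (n + 1) (Fin.cons c fun _ => a) := by
  induction i using Fin.induction with
  | zero =>
    congr 1
    ext j
    refine Fin.cases (by simp) (fun j => ?_) j
    simp
  | succ i ih =>
    rw [← ih, ← Phi_comp_swap f n i]
    congr 1
    ext j
    simp only [Function.comp_apply, Function.update_apply, Equiv.swap_apply_eq_iff,
      Equiv.swap_apply_right]

lemma succ_mul_psi_succ (a : A) (k : ℕ) :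
    ((k : B) + 1) * psi f a (k + 1) =
      ∑ j ∈ Finset.range (k + 1), (-1 : B) ^ j * f (a ^ (j + 1)) * psi f a (k - j) := by
  rw [psi]
  have h : ((k : B) + 1) = algebraMap ℝ B ((k : ℝ) + 1) := by simp
  rw [h, ← Algebra.smul_def, smul_smul, mul_inv_cancel₀ (by positivity), one_smul]

/-- `Φ_k` on the diagonal is `k! · ψ_k`, together with the expansion of
`Φ_{k+1}(f; a^{m+1}, a, …, a)` needed to prove it. -/
lemma Phi_const_and_cons_pow (a : A) (k : ℕ) :
    Phi f k (fun _ => a) = (k.factorial : B) * psi f a k ∧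
      ∀ m : ℕ, Phi f (k + 1) (Fin.cons (a ^ (m + 1)) fun _ => a) =
        (k.factorial : B) * ∑ j ∈ Finset.range (k + 1),
          (-1 : B) ^ j * f (a ^ (m + j + 1)) * psi f a (k - j) := by
  induction k with
  | zero => simp [Phi, psi]
  | succ k ih =>
    have hconst : Phi f (k + 1) (fun _ => a) = ((k + 1).factorial : B) * psi f a (k + 1) := by
      have h := ih.2 0
      have hc : (Fin.cons (a ^ (0 + 1)) fun _ => a : Fin (k + 1) → A) = fun _ => a := by
        ext j
        refine Fin.cases (by simp) (fun j => by simp) j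
      simp only [zero_add] at h hc
      rw [hc, ← succ_mul_psi_succ] at h
      rw [h, Nat.factorial_succ]
      push_cast
      ring
    refine ⟨hconst, fun m => ?_⟩
    rw [Phi_cons, hconst, Finset.sum_range_succ']
    have hupd : ∀ i : Fin (k + 1), Phi f (k + 1) (mulAt (a ^ (m + 1)) i fun _ => a) =
        (k.factorial : B) * ∑ j ∈ Finset.range (k + 1),
          (-1 : B) ^ j * f (a ^ (m + 1 + j + 1)) * psi f a (k - j) := by
      intro i
      rw [mulAt, Phi_update_const, ← pow_succ, ih.2]
    simp only [hupd, Finset.sum_const, Finset.card_univ, Fintype.card_fin, nsmul_eq_mul]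
    have hsum : ∑ j ∈ Finset.range (k + 1),
          (-1 : B) ^ (j + 1) * f (a ^ (m + (j + 1) + 1)) * psi f a (k + 1 - (j + 1)) =
        -∑ j ∈ Finset.range (k + 1),
          (-1 : B) ^ j * f (a ^ (m + 1 + j + 1)) * psi f a (k - j) := by
      rw [← Finset.sum_neg_distrib]
      refine Finset.sum_congr rfl fun j _ => ?_
      rw [Nat.add_sub_add_right, show m + (j + 1) + 1 = m + 1 + j + 1 by ring]
      ring
    rw [hsum, Nat.factorial_succ]
    push_cast
    simp only [pow_zero, add_zero]
    ring

lemma inv_factorial_smul_Phi_const (a : A) (k : ℕ) :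
    ((k.factorial : ℝ)⁻¹) • Phi f k (fun _ => a) = psi f a k := by
  have h : (k.factorial : B) = algebraMap ℝ B (k.factorial : ℝ) := by simp
  rw [(Phi_const_and_cons_pow f a k).1, h, ← Algebra.smul_def, smul_smul,
    inv_mul_cancel₀ (by positivity), one_smul]

/-- If `Φ_{n+1}(f; ·) = 0`, then `Φ_k · Φ_n` is the sum, over all injective placements of the
arguments of `Φ_k` among those of `Φ_n`, of `Φ_n` of the multiplied arguments. -/
lemma Phi_mul_Phi {n : ℕ} (hf : ∀ a : Fin (n + 1) → A, Phi f (n + 1) a = 0) (k : ℕ)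
    (x : Fin k → A) (a : Fin n → A) :
    Phi f k x * Phi f n a =
      ∑ ι : Fin k → Fin n, open Classical in
        if Function.Injective ι then Phi f n (mulAlong x ι a) else 0 := by
  classical
  induction k with
  | zero =>
    have h : Function.Injective (default : Fin 0 → Fin n) := Function.injective_of_subsingleton _
    have h' : mulAlong x default a = a := by ext i; simp [mulAlong]
    simp [Phi, h, h']
  | succ k ih =>
    have hmul : ∀ (y : A) (c : Fin n → A), f y * Phi f n c = ∑ m, Phi f n (mulAt y m c) := by
      intro y c
      rw [← sub_eq_zero, ← Phi_cons]
      exact hf _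
    obtain ⟨y, x, rfl⟩ : ∃ y z, x = (Fin.cons y z : Fin (k + 1) → A) :=
      ⟨x 0, Fin.tail x, (Fin.cons_self_tail x).symm⟩
    rw [Phi_cons, sub_mul, mul_assoc, ih, Finset.sum_mul]
    simp only [ih, mulAlong_mulAt]
    have hsum : ∀ g : (Fin (k + 1) → Fin n) → B,
        ∑ ι, g ι = ∑ ι : Fin k → Fin n, ∑ m : Fin n, g (Fin.cons m ι) := by
      intro g
      rw [← Fintype.sum_prod_type_right']
      exact ((Fin.consEquiv fun _ => Fin n).sum_comp g).symm
    rw [hsum, Finset.mul_sum, Finset.sum_comm, ← Finset.sum_sub_distrib]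
    refine Finset.sum_congr rfl fun ι _ => ?_
    simp only [Fin.cons_injective_iff, mulAlong_cons]
    by_cases hι : Function.Injective ι
    · simp only [hι, if_true, and_true, hmul]
      rw [← Finset.sum_filter, sub_eq_iff_eq_add,
        ← Finset.sum_filter_add_sum_filter_not Finset.univ (fun m => m ∉ Set.range ι)]
      congr 1
      have himage : Finset.univ.filter (fun m => ¬ m ∉ Set.range ι) = Finset.univ.image ι := by
        ext m; simp
      rw [himage, Finset.sum_image hι.injOn]
    · simp [hι]

lemma Phi_const_mul_Phi_const {n : ℕ} (hf : ∀ a : Fin (n + 1) → A, Phi f (n + 1) a = 0)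
    (a b : A) :
    Phi f n (fun _ => a) * Phi f n (fun _ => b) =
      (n.factorial : B) * Phi f n (fun _ => a * b) := by
  classical
  rw [Phi_mul_Phi f hf]
  have hterm : ∀ ι : Fin n → Fin n, Function.Injective ι →
      mulAlong (fun _ => a) ι (fun _ => b) = fun _ => a * b := by
    intro ι hι
    ext i
    obtain ⟨j, rfl⟩ := Finite.surjective_of_injective hι i
    simp [mulAlong, hι.eq_iff]
  have hcard : (Finset.univ.filter fun ι : Fin n → Fin n => Function.Injective ι).card =
      n.factorial := by
    rw [← Fintype.card_subtype,
      Fintype.card_congr (Equiv.subtypeInjectiveEquivEmbedding (Fin n) (Fin n))]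
    simp [Fintype.card_embedding_eq, Nat.descFactorial_self]
  rw [← Finset.sum_filter, ← hcard, ← nsmul_eq_mul]
  refine Finset.sum_eq_card_nsmul fun ι hι => ?_
  rw [hterm ι (Finset.mem_filter.mp hι).2]

lemma Phi_one {n : ℕ} (hf : f 1 = (n : B)) (k : ℕ) (hk : k ≤ n) :
    Phi f k (fun _ => 1) = (n.descFactorial k : B) := by
  induction k with
  | zero => simp [Phi]
  | succ k ih =>
    have hone : ∀ i : Fin k, mulAt (1 : A) i (fun _ => 1) = fun _ => 1 := by
      intro i; ext j; simp [mulAt_apply]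
    have h := Phi_succ f k (fun _ => 1)
    simp only [Fin.tail_def, hone, Finset.sum_const, Finset.card_univ, Fintype.card_fin,
      nsmul_eq_mul, hf, ih (by omega)] at h
    rw [h, Nat.descFactorial_succ]
    push_cast [Nat.cast_sub (show k ≤ n by omega)]
    ring

end FrobeniusForms

/-- If `f` is an `n`-homomorphism then `a ↦ ψ_n(f,a)` is multiplicative and unital;
equivalently, the diagonal restriction of `(1/n!)·Φ_n(f; ·)` is multiplicative in `a`. -/
theorem psi_n_multiplicative [CommRing A] [CommRing B] [Algebra ℝ A] [Algebra ℝ B]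
    (n : ℕ) (f : A →ₗ[ℝ] B) (hf : IsNHom n f) :
    (∀ a b : A, psi f (a * b) n = psi f a n * psi f b n) ∧ psi f 1 n = 1 ∧
      ∀ a b : A,
        ((n.factorial : ℝ)⁻¹) • Phi f n (fun _ => a * b) =
          (((n.factorial : ℝ)⁻¹) • Phi f n (fun _ => a)) *
            (((n.factorial : ℝ)⁻¹) • Phi f n (fun _ => b)) := by
  have hmul : ∀ a b : A, psi f (a * b) n = psi f a n * psi f b n := by
    intro a b
    have h := Phi_const_mul_Phi_const f hf.2 a b
    have hn : (n.factorial : B) = algebraMap ℝ B (n.factorial : ℝ) := by simp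
    rw [← inv_factorial_smul_Phi_const, ← inv_factorial_smul_Phi_const f a,
      ← inv_factorial_smul_Phi_const f b, smul_mul_smul_comm, h, hn, ← Algebra.smul_def,
      smul_smul, mul_assoc, inv_mul_cancel₀ (by positivity), mul_one]
  refine ⟨hmul, ?_, fun a b => ?_⟩
  · have hn : (n.factorial : B) = algebraMap ℝ B (n.factorial : ℝ) := by simp
    rw [← inv_factorial_smul_Phi_const, Phi_one f hf.1 n le_rfl, Nat.descFactorial_self, hn,
      ← algebraMap_smul B, smul_eq_mul, ← map_mul, inv_mul_cancel₀ (by positivity), map_one]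
  · simp only [inv_factorial_smul_Phi_const, hmul]

end
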